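/- arXiv:2604.08219 — 3 statements merged into one kernel-verified Lean document; each statement's English description precedes it below -/
import Mathlib

section
/- Let R ∈ ℝ^{n×n} be row-stochastic and primitive, and let π ∈ ℝⁿ satisfy πᵀ R = πᵀ, π > 0 entrywise, and πᵀ 𝟙 = 1. Set Π := 𝟙 πᵀ. Then there exist an invertible matrix S ∈ ℝ^{n×n} and a constant ρ ∈ (0,1) such that for every x ∈ ℝⁿ, ‖S(Rx − Πx)‖₂ ≤ ρ ‖S(x − Πx)‖₂, where ‖·‖₂ is the Euclidean norm; i.e., R contracts strictly towards its stationary projection Π in the weighted norm x ↦ ‖Sx‖₂. -/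
open Matrix BigOperators

/-- A nonnegative square matrix is primitive if some power has all entries strictly positive. -/
def Matrix.IsPrimitiveReal {n : ℕ} (A : Matrix (Fin n) (Fin n) ℝ) : Prop :=
  ∃ m : ℕ, 0 < m ∧ ∀ i j, 0 < (A ^ m) i j

/-- Euclidean norm of a vector in `ℝⁿ`. -/
noncomputable def euclNorm {n : ℕ} (v : Fin n → ℝ) : ℝ :=
  Real.sqrt (∑ i, (v i) ^ 2)

/-- A matrix with unit row sums and stationary vector `π` whose rows dominate `α • π` contracts
vectors of `π`-mean zero by the factor `1 - α` in the `π`-weighted Euclidean norm. -/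
lemma sum_mul_sq_mulVec_le_of_minorized {ι : Type*} [Fintype ι] {A : Matrix ι ι ℝ} {π : ι → ℝ}
    {α : ℝ} (hrow : ∀ i, ∑ j, A i j = 1) (hπ : ∀ i, 0 ≤ π i) (hsum : ∑ i, π i = 1)
    (hstat : π ᵥ* A = π) (hmin : ∀ i j, α * π j ≤ A i j) {y : ι → ℝ} (hy : π ⬝ᵥ y = 0) :
    ∑ i, π i * (A *ᵥ y) i ^ 2 ≤ (1 - α) ^ 2 * ∑ i, π i * y i ^ 2 := by
  have hmulVec (i : ι) : (A *ᵥ y) i = ∑ j, (A i j - α * π j) * y j := by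
    have hαy : ∑ j, α * π j * y j = 0 := by
      simp_rw [mul_assoc, ← Finset.mul_sum]
      exact mul_eq_zero_of_right α hy
    simp_rw [sub_mul, Finset.sum_sub_distrib, hαy, sub_zero]
    rfl
  have hrow_sq (i : ι) : (A *ᵥ y) i ^ 2 ≤ (1 - α) * ∑ j, (A i j - α * π j) * y j ^ 2 := by
    have hb (j : ι) : 0 ≤ A i j - α * π j := sub_nonneg.2 (hmin i j)
    have hbsum : ∑ j, (A i j - α * π j) = 1 - α := by
      rw [Finset.sum_sub_distrib, hrow, ← Finset.mul_sum, hsum, mul_one]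
    rw [hmulVec, ← hbsum]
    refine Finset.sum_sq_le_sum_mul_sum_of_sq_le_mul _ (fun j _ => hb j)
      (fun j _ => mul_nonneg (hb j) (sq_nonneg _)) fun j _ => le_of_eq (by ring)
  have hcol (j : ι) : ∑ i, π i * (A i j - α * π j) = (1 - α) * π j := by
    have hj : ∑ i, π i * A i j = π j := congrFun hstat j
    simp_rw [mul_sub, Finset.sum_sub_distrib, hj, ← Finset.sum_mul, hsum]
    ring
  calc
    ∑ i, π i * (A *ᵥ y) i ^ 2
      ≤ ∑ i, π i * ((1 - α) * ∑ j, (A i j - α * π j) * y j ^ 2) :=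
        Finset.sum_le_sum fun i _ => mul_le_mul_of_nonneg_left (hrow_sq i) (hπ i)
    _ = (1 - α) * ∑ j, (∑ i, π i * (A i j - α * π j)) * y j ^ 2 := by
        simp_rw [Finset.mul_sum, Finset.sum_mul, Finset.mul_sum]
        rw [Finset.sum_comm]
        exact Finset.sum_congr rfl fun _ _ => Finset.sum_congr rfl fun _ _ => by ring
    _ = (1 - α) ^ 2 * ∑ j, π j * y j ^ 2 := by
        simp_rw [hcol, Finset.mul_sum]
        exact Finset.sum_congr rfl fun _ _ => by ring

/-- If `a m ≤ θ ^ m * a 0`, then the weighted sum `∑ k < m, θ⁻¹ ^ k * a k` contracts by `θ` under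
the shift of `a`. -/
lemma sum_range_inv_pow_mul_succ_le {θ : ℝ} (hθ : 0 < θ) {m : ℕ} (hm : 0 < m) {a : ℕ → ℝ}
    (ha : a m ≤ θ ^ m * a 0) :
    ∑ k ∈ Finset.range m, θ⁻¹ ^ k * a (k + 1) ≤ θ * ∑ k ∈ Finset.range m, θ⁻¹ ^ k * a k := by
  obtain ⟨l, rfl⟩ := Nat.exists_eq_add_of_le' hm
  rw [Finset.sum_range_succ, Finset.sum_range_succ', mul_add, Finset.mul_sum]
  refine add_le_add (Finset.sum_le_sum fun k _ => le_of_eq ?_) ?_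
  · rw [pow_succ]
    field_simp
  · calc
      θ⁻¹ ^ l * a (l + 1) ≤ θ⁻¹ ^ l * (θ ^ (l + 1) * a 0) := by gcongr
      _ = θ * (θ⁻¹ ^ 0 * a 0) := by
        rw [inv_pow, pow_succ]
        field_simp

lemma dotProduct_transpose_mul_diagonal_mul_mulVec {ι : Type*} [Fintype ι] [DecidableEq ι]
    (B : Matrix ι ι ℝ) (w v : ι → ℝ) :
    v ⬝ᵥ ((Bᵀ * diagonal w * B) *ᵥ v) = ∑ i, w i * (B *ᵥ v) i ^ 2 := by
  rw [← mulVec_mulVec, ← mulVec_mulVec, dotProduct_mulVec, vecMul_transpose]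
  exact Finset.sum_congr rfl fun i _ => by rw [mulVec_diagonal]; ring

lemma sum_sq_mulVec_eq_dotProduct {ι : Type*} [Fintype ι] (S : Matrix ι ι ℝ) (v : ι → ℝ) :
    ∑ i, (S *ᵥ v) i ^ 2 = v ⬝ᵥ ((Sᵀ * S) *ᵥ v) := by
  rw [← mulVec_mulVec, dotProduct_mulVec, vecMul_transpose]
  exact Finset.sum_congr rfl fun i _ => sq _

open scoped MatrixOrder Matrix.Norms.L2Operator in
/-- A positive combination of the forms `v ↦ ∑ i, w i * (B ^ k *ᵥ v) i ^ 2`, `k < m`, is the square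
of a Euclidean norm transported by an invertible matrix. -/
lemma exists_isUnit_sum_sq_mulVec_eq {ι : Type*} [Fintype ι] [DecidableEq ι] (B : Matrix ι ι ℝ)
    {w : ι → ℝ} (hw : ∀ i, 0 < w i) {c : ℝ} (hc : 0 < c) {m : ℕ} (hm : 0 < m) :
    ∃ S : Matrix ι ι ℝ, IsUnit S ∧ ∀ v : ι → ℝ, ∑ i, (S *ᵥ v) i ^ 2 =
      ∑ k ∈ Finset.range m, c ^ k * ∑ i, w i * (B ^ k *ᵥ v) i ^ 2 := by
  set P : Matrix ι ι ℝ := ∑ k ∈ Finset.range m, c ^ k • ((B ^ k)ᵀ * diagonal w * B ^ k) with hP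
  have hform (v : ι → ℝ) : v ⬝ᵥ (P *ᵥ v) =
      ∑ k ∈ Finset.range m, c ^ k * ∑ i, w i * (B ^ k *ᵥ v) i ^ 2 := by
    simp_rw [hP, sum_mulVec, dotProduct_sum, smul_mulVec, dotProduct_smul,
      dotProduct_transpose_mul_diagonal_mul_mulVec, smul_eq_mul]
  have hterm (v : ι → ℝ) (k : ℕ) : 0 ≤ c ^ k * ∑ i, w i * (B ^ k *ᵥ v) i ^ 2 :=
    mul_nonneg (pow_nonneg hc.le k)
      (Finset.sum_nonneg fun i _ => mul_nonneg (hw i).le (sq_nonneg _))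
  have hPos : P.PosDef := by
    refine .of_dotProduct_mulVec_pos ?_ fun v hv => ?_
    · simp [hP, IsHermitian, conjTranspose_eq_transpose_of_trivial, transpose_sum, mul_assoc]
    · obtain ⟨i, hi⟩ := Function.ne_iff.1 hv
      rw [star_trivial, hform]
      refine Finset.sum_pos' (fun k _ => hterm v k) ⟨0, Finset.mem_range.2 hm, ?_⟩
      rw [pow_zero, one_mul, pow_zero, one_mulVec]
      exact Finset.sum_pos' (fun j _ => mul_nonneg (hw j).le (sq_nonneg _))
        ⟨i, Finset.mem_univ i, mul_pos (hw i) (sq_pos_of_ne_zero hi)⟩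
  obtain ⟨S, hS, hPS⟩ : ∃ S : Matrix ι ι ℝ, IsUnit S ∧ P = Sᵀ * S :=
    CStarAlgebra.isStrictlyPositive_iff_eq_star_mul_self.1 hPos.isStrictlyPositive
  exact ⟨S, hS, fun v => by rw [sum_sq_mulVec_eq_dotProduct, ← hPS, hform]⟩

/-- A row-stochastic matrix with a positive power contracts, after that many steps, vectors of
`π`-mean zero in the `π`-weighted Euclidean norm. -/
lemma exists_sum_mul_sq_pow_mulVec_le {ι : Type*} [Fintype ι] [DecidableEq ι] {R : Matrix ι ι ℝ}
    (hR : R ∈ rowStochastic ℝ ι) {m : ℕ} (hpos : ∀ i j, 0 < (R ^ m) i j) {π : ι → ℝ}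
    (hπ : ∀ i, 0 ≤ π i) (hstat : π ᵥ* R = π) (hsum : ∑ i, π i = 1) :
    ∃ β ∈ Set.Ioo (0 : ℝ) 1, ∀ y : ι → ℝ, π ⬝ᵥ y = 0 →
      ∑ i, π i * (R ^ m *ᵥ y) i ^ 2 ≤ β * ∑ i, π i * y i ^ 2 := by
  have hRm : R ^ m ∈ rowStochastic ℝ ι := pow_mem hR m
  have hstat_pow : π ᵥ* R ^ m = π := by
    clear hpos hRm
    induction m with
    | zero => simp
    | succ k ih => rw [pow_succ, ← vecMul_vecMul, ih, hstat]
  have : Nonempty ι := by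
    by_contra h
    rw [not_nonempty_iff] at h
    simp at hsum
  obtain ⟨⟨p, q⟩, hpq⟩ := Finite.exists_min fun ij : ι × ι => (R ^ m) ij.1 ij.2
  have hp0 := hpos p q
  have hp1 : (R ^ m) p q ≤ 1 := le_one_of_mem_rowStochastic hRm
  refine ⟨(1 - (R ^ m) p q / 2) ^ 2, ⟨by nlinarith, by nlinarith⟩, fun y hy =>
    sum_mul_sq_mulVec_le_of_minorized (sum_row_of_mem_rowStochastic hRm) hπ hsum hstat_pow
      (fun i j => ?_) hy⟩
  have hπ1 : π j ≤ 1 := hsum ▸ Finset.single_le_sum (fun i _ => hπ i) (Finset.mem_univ j)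
  have hij : (R ^ m) p q ≤ (R ^ m) i j := hpq (i, j)
  nlinarith [hπ j]

/-- **Strict geometric mixing for a primitive row-stochastic matrix.**
If `R` is row-stochastic and primitive with positive stationary vector `π`
(`πᵀ R = πᵀ`, `πᵀ 𝟙 = 1`), and `Π := 𝟙 πᵀ`, then there exist an invertible
matrix `S` and `ρ ∈ (0,1)` such that for every `x ∈ ℝⁿ`,
`‖S (R x − Π x)‖₂ ≤ ρ ‖S (x − Π x)‖₂`. -/
theorem exists_weighted_norm_contraction_row_stochastic {n : ℕ}
    (R : Matrix (Fin n) (Fin n) ℝ)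
    (hR_nonneg : ∀ i j, 0 ≤ R i j) (hR_row : ∀ i, ∑ j, R i j = 1)
    (hprim : R.IsPrimitiveReal)
    (π : Fin n → ℝ) (hπ_pos : ∀ i, 0 < π i)
    (hπ_stat : Matrix.vecMul π R = π)
    (hπ_sum : ∑ i, π i = 1) :
    ∃ (S : Matrix (Fin n) (Fin n) ℝ) (ρ : ℝ), IsUnit S ∧ ρ ∈ Set.Ioo (0 : ℝ) 1 ∧
      ∀ x : Fin n → ℝ,
        euclNorm (S.mulVec (R.mulVec x - (Matrix.vecMulVec (fun _ => (1 : ℝ)) π).mulVec x)) ≤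
          ρ * euclNorm (S.mulVec (x - (Matrix.vecMulVec (fun _ => (1 : ℝ)) π).mulVec x)) := by
  obtain ⟨m, hm, hpos⟩ := hprim
  have hR : R ∈ rowStochastic ℝ (Fin n) := mem_rowStochastic_iff_sum.2 ⟨hR_nonneg, hR_row⟩
  obtain ⟨β, ⟨hβ0, hβ1⟩, hβ⟩ :=
    exists_sum_mul_sq_pow_mulVec_le hR hpos (fun i => (hπ_pos i).le) hπ_stat hπ_sum
  obtain ⟨θ, hθ0, hθ1, hθm⟩ : ∃ θ : ℝ, 0 < θ ∧ θ < 1 ∧ θ ^ m = β :=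
    ⟨β ^ (m⁻¹ : ℝ), Real.rpow_pos_of_pos hβ0 _,
      Real.rpow_lt_one hβ0.le hβ1 (inv_pos.2 (Nat.cast_pos.2 hm)),
      Real.rpow_inv_natCast_pow hβ0.le hm.ne'⟩
  obtain ⟨S, hS, hSform⟩ := exists_isUnit_sum_sq_mulVec_eq R hπ_pos (inv_pos.2 hθ0) hm
  refine ⟨S, √θ, hS, ⟨Real.sqrt_pos.2 hθ0, (Real.sqrt_lt' one_pos).2 (by simpa using hθ1)⟩,
    fun x => ?_⟩
  have hproj : (vecMulVec (fun _ => (1 : ℝ)) π) *ᵥ x = (π ⬝ᵥ x) • (1 : Fin n → ℝ) := by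
    ext i
    simp [vecMulVec_mulVec]
  rw [hproj]
  set y := x - (π ⬝ᵥ x) • (1 : Fin n → ℝ) with hy
  have hRy : R *ᵥ x - (π ⬝ᵥ x) • (1 : Fin n → ℝ) = R *ᵥ y := by
    rw [hy, mulVec_sub, mulVec_smul, one_vecMul_of_mem_rowStochastic hR]
  have hy0 : π ⬝ᵥ y = 0 := by
    rw [hy, dotProduct_sub, dotProduct_smul, dotProduct_one, hπ_sum, smul_eq_mul, mul_one, sub_self]
  rw [hRy, euclNorm, euclNorm, ← Real.sqrt_mul hθ0.le, hSform, hSform]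
  simp_rw [mulVec_mulVec, ← pow_succ]
  refine Real.sqrt_le_sqrt
    (sum_range_inv_pow_mul_succ_le (a := fun k => ∑ i, π i * (R ^ k *ᵥ y) i ^ 2) hθ0 hm ?_)
  simpa [hθm] using hβ y hy0
end

section
/- Let (Ω, 𝓕, ℙ) be a probability space and 𝓖 ⊆ 𝓕 a sub-σ-algebra. Let f_1, …, f_n : ℝ^d → ℝ each be differentiable with L-Lipschitz continuous gradient, and for a matrix Y ∈ ℝ^{n×d} with rows y_iᵀ let ∇𝐅(Y) denote the matrix whose i-th row is ∇f_i(y_i)ᵀ. Let X, X⁺, M : Ω → ℝ^{n×d} be 𝓖-measurable and square-integrable, and let G : Ω → ℝ^{n×d} be square-integrable with 𝔼[G | 𝓖] = ∇𝐅(X⁺) almost surely and 𝔼‖G − ∇𝐅(X⁺)‖_F² ≤ n σ². Fix λ ∈ (0,1] and set M⁺ := (1 − λ) M + λ G. Then 𝔼‖M⁺ − ∇𝐅(X⁺)‖_F² ≤ (1 − λ) 𝔼‖M − ∇𝐅(X)‖_F² + ((1 − λ)²/λ) L² 𝔼‖X⁺ − X‖_F² + λ² n σ². -/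
open Matrix BigOperators MeasureTheory

/-- Frobenius norm of an `n × d` real matrix. -/
noncomputable def frobNorm {n d : ℕ} (X : Matrix (Fin n) (Fin d) ℝ) : ℝ :=
  Real.sqrt (∑ i, ∑ j, (X i j) ^ 2)

/-- The gradient matrix `∇𝐅(Y)` whose `i`-th row is `∇f_i(y_i)ᵀ`, where `y_iᵀ` is the
`i`-th row of `Y`. -/
noncomputable def gradMat {n d : ℕ} (f : Fin n → EuclideanSpace ℝ (Fin d) → ℝ)
    (Y : Matrix (Fin n) (Fin d) ℝ) : Matrix (Fin n) (Fin d) ℝ :=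
  Matrix.of fun i j =>
    (EuclideanSpace.equiv (Fin d) ℝ)
      (gradient (f i) ((EuclideanSpace.equiv (Fin d) ℝ).symm (Y i))) j

theorem frobNorm_sq {n d : ℕ} (Y : Matrix (Fin n) (Fin d) ℝ) :
    frobNorm Y ^ 2 = ∑ i, ∑ j, Y i j ^ 2 :=
  Real.sq_sqrt (Finset.sum_nonneg fun _ _ => Finset.sum_nonneg fun _ _ => sq_nonneg _)

theorem sq_entry_le_frobNorm_sq {n d : ℕ} (Y : Matrix (Fin n) (Fin d) ℝ) (i : Fin n) (j : Fin d) :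
    Y i j ^ 2 ≤ frobNorm Y ^ 2 := by
  rw [frobNorm_sq]
  calc Y i j ^ 2 ≤ ∑ j, Y i j ^ 2 :=
        Finset.single_le_sum (f := fun j => Y i j ^ 2) (fun _ _ => sq_nonneg _)
          (Finset.mem_univ j)
    _ ≤ ∑ i, ∑ j, Y i j ^ 2 :=
        Finset.single_le_sum (f := fun i => ∑ j, Y i j ^ 2)
          (fun _ _ => Finset.sum_nonneg fun _ _ => sq_nonneg _) (Finset.mem_univ i)

theorem integrable_frobNorm_sq {Ω : Type*} {_ : MeasurableSpace Ω} {μ : Measure Ω} {n d : ℕ}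
    {Y : Ω → Matrix (Fin n) (Fin d) ℝ} (hY : ∀ i j, MemLp (fun ω => Y ω i j) 2 μ) :
    Integrable (fun ω => frobNorm (Y ω) ^ 2) μ := by
  simp only [frobNorm_sq]
  exact integrable_finsetSum _ fun i _ => integrable_finsetSum _ fun j _ => (hY i j).integrable_sq

theorem frobNorm_gradMat_sub_sq_le {n d : ℕ} {L : ℝ}
    {f : Fin n → EuclideanSpace ℝ (Fin d) → ℝ}
    (hlip : ∀ i, ∀ x y : EuclideanSpace ℝ (Fin d),
      ‖gradient (f i) x - gradient (f i) y‖ ≤ L * ‖x - y‖)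
    (Y Z : Matrix (Fin n) (Fin d) ℝ) :
    frobNorm (gradMat f Y - gradMat f Z) ^ 2 ≤ L ^ 2 * frobNorm (Y - Z) ^ 2 := by
  rw [frobNorm_sq, frobNorm_sq, Finset.mul_sum]
  refine Finset.sum_le_sum fun i _ => ?_
  have h := pow_le_pow_left₀ (norm_nonneg _) (hlip i ((EuclideanSpace.equiv (Fin d) ℝ).symm (Y i))
    ((EuclideanSpace.equiv (Fin d) ℝ).symm (Z i))) 2
  rw [mul_pow, EuclideanSpace.real_norm_sq_eq, EuclideanSpace.real_norm_sq_eq] at h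
  simpa [gradMat] using h

theorem measurable_gradMat_entry {Ω : Type*} {m : MeasurableSpace Ω} {n d : ℕ} {L : ℝ}
    {f : Fin n → EuclideanSpace ℝ (Fin d) → ℝ}
    (hlip : ∀ i, ∀ x y : EuclideanSpace ℝ (Fin d),
      ‖gradient (f i) x - gradient (f i) y‖ ≤ L * ‖x - y‖)
    {Y : Ω → Matrix (Fin n) (Fin d) ℝ} (hY : ∀ i j, Measurable fun ω => Y ω i j)
    (i : Fin n) (j : Fin d) :
    Measurable fun ω => gradMat f (Y ω) i j := by
  have hgrad : Continuous (gradient (f i)) :=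
    (LipschitzWith.of_dist_le' (K := L) fun x y => by
      simpa only [dist_eq_norm] using hlip i x y).continuous
  have hcont : Continuous fun v : Fin d → ℝ =>
      (EuclideanSpace.equiv (Fin d) ℝ)
        (gradient (f i) ((EuclideanSpace.equiv (Fin d) ℝ).symm v)) j :=
    (continuous_apply j).comp ((EuclideanSpace.equiv (Fin d) ℝ).continuous.comp
      (hgrad.comp (EuclideanSpace.equiv (Fin d) ℝ).symm.continuous))
  exact hcont.measurable.comp (measurable_pi_lambda (fun ω => Y ω i) (hY i))

/-- The error of a square-integrable `g` with respect to its conditional expectation is orthogonal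
to every square-integrable function measurable for the conditioning σ-algebra. -/
theorem integral_mul_sub_condExp_eq_zero {Ω : Type*} {m m₀ : MeasurableSpace Ω}
    {μ : Measure Ω} [IsFiniteMeasure μ] (hm : m ≤ m₀) {u g a : Ω → ℝ}
    (hu : Measurable[m] u) (hu2 : MemLp u 2 μ) (hg2 : MemLp g 2 μ) (ha2 : MemLp a 2 μ)
    (hga : μ[g | m] =ᵐ[μ] a) :
    ∫ ω, u ω * (g ω - a ω) ∂μ = 0 := by
  have hug : Integrable (u * g) μ := hu2.integrable_mul hg2
  have hua : Integrable (u * a) μ := hu2.integrable_mul ha2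
  have hpull : μ[u * g | m] =ᵐ[μ] u * a :=
    (condExp_mul_of_stronglyMeasurable_left hu.stronglyMeasurable hug
      (hg2.integrable one_le_two)).trans (Filter.EventuallyEq.rfl.mul hga)
  have heq : ∫ ω, (u * g) ω ∂μ = ∫ ω, (u * a) ω ∂μ := by
    rw [← integral_condExp hm, integral_congr_ae hpull]
  calc ∫ ω, u ω * (g ω - a ω) ∂μ = ∫ ω, ((u * g) ω - (u * a) ω) ∂μ := by
        simp only [mul_sub, Pi.mul_apply]
    _ = 0 := by rw [integral_sub hug hua, heq, sub_self]

/-- Young's inequality for the momentum update, applied to the error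
`(1 - t) * p + t * g - a` with intermediate point `b`. -/
theorem sq_momentum_error_le {t : ℝ} (ht : 0 < t) (ht1 : t ≤ 1) (p g a b : ℝ) :
    ((1 - t) * p + t * g - a) ^ 2 ≤
      (1 - t) * (p - b) ^ 2 + (1 - t) ^ 2 / t * (a - b) ^ 2 + t ^ 2 * (g - a) ^ 2
        + 2 * t * (1 - t) * ((p - a) * (g - a)) := by
  have key : (1 - t) * (p - b) ^ 2 + (1 - t) ^ 2 / t * (a - b) ^ 2 + t ^ 2 * (g - a) ^ 2
        + 2 * t * (1 - t) * ((p - a) * (g - a)) - ((1 - t) * p + t * g - a) ^ 2 =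
      (1 - t) / t * (t * (p - b) + (1 - t) * (a - b)) ^ 2 := by
    field_simp
    ring
  have : 0 ≤ (1 - t) / t * (t * (p - b) + (1 - t) * (a - b)) ^ 2 :=
    mul_nonneg (div_nonneg (sub_nonneg.mpr ht1) ht.le) (sq_nonneg _)
  linarith

/-- **Momentum approximation error recursion.**
On a probability space with sub-σ-algebra `m ≤ 𝓕`: if `X, X⁺, M` are `m`-measurable and
square-integrable (entrywise), `G` is square-integrable with `𝔼[G|m] = ∇𝐅(X⁺)` a.s.
(entrywise) and `𝔼‖G − ∇𝐅(X⁺)‖_F² ≤ n σ²`, and `M⁺ := (1 − λ) M + λ G` with `λ ∈ (0,1]`,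
then `𝔼‖M⁺ − ∇𝐅(X⁺)‖_F² ≤ (1−λ) 𝔼‖M − ∇𝐅(X)‖_F² + ((1−λ)²/λ) L² 𝔼‖X⁺ − X‖_F² + λ² n σ²`. -/
theorem momentum_approximation_error {Ω : Type*} [msΩ : MeasurableSpace Ω]
    (μ : Measure Ω) [IsProbabilityMeasure μ]
    (m : MeasurableSpace Ω) (hm : m ≤ msΩ)
    {n d : ℕ} (L σ lam : ℝ) (hlam : lam ∈ Set.Ioc (0 : ℝ) 1)
    (f : Fin n → EuclideanSpace ℝ (Fin d) → ℝ)
    (hdiff : ∀ i, Differentiable ℝ (f i))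
    (hlip : ∀ i, ∀ x y : EuclideanSpace ℝ (Fin d),
      ‖gradient (f i) x - gradient (f i) y‖ ≤ L * ‖x - y‖)
    (X Xp M G : Ω → Matrix (Fin n) (Fin d) ℝ)
    (hXmeas : ∀ i j, Measurable[m] fun ω => X ω i j)
    (hXpmeas : ∀ i j, Measurable[m] fun ω => Xp ω i j)
    (hMmeas : ∀ i j, Measurable[m] fun ω => M ω i j)
    (hXL2 : ∀ i j, MemLp (fun ω => X ω i j) 2 μ)
    (hXpL2 : ∀ i j, MemLp (fun ω => Xp ω i j) 2 μ)
    (hML2 : ∀ i j, MemLp (fun ω => M ω i j) 2 μ)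
    (hGL2 : ∀ i j, MemLp (fun ω => G ω i j) 2 μ)
    (hGcond : ∀ i j, μ[fun ω => G ω i j | m] =ᵐ[μ] fun ω => gradMat f (Xp ω) i j)
    (hGvar : ∫ ω, frobNorm (G ω - gradMat f (Xp ω)) ^ 2 ∂μ ≤ (n : ℝ) * σ ^ 2) :
    ∫ ω, frobNorm ((1 - lam) • M ω + lam • G ω - gradMat f (Xp ω)) ^ 2 ∂μ ≤
      (1 - lam) * ∫ ω, frobNorm (M ω - gradMat f (X ω)) ^ 2 ∂μ
        + ((1 - lam) ^ 2 / lam) * L ^ 2 * ∫ ω, frobNorm (Xp ω - X ω) ^ 2 ∂μ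
        + lam ^ 2 * (n : ℝ) * σ ^ 2 := by
  obtain ⟨hpos, hle⟩ := hlam
  have hAmeas := measurable_gradMat_entry hlip hXpmeas
  have hBmeas := measurable_gradMat_entry hlip hXmeas
  have hA2 : ∀ i j, MemLp (fun ω => gradMat f (Xp ω) i j) 2 μ := fun i j =>
    (memLp_congr_ae (hGcond i j)).mp ((hGL2 i j).condExp one_le_two)
  have hstep : Integrable (fun ω => frobNorm (Xp ω - X ω) ^ 2) μ :=
    integrable_frobNorm_sq fun i j => (hXpL2 i j).sub (hXL2 i j)
  have hAB2 : ∀ i j, MemLp (fun ω => gradMat f (Xp ω) i j - gradMat f (X ω) i j) 2 μ := by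
    intro i j
    have hmeas : AEStronglyMeasurable[msΩ]
        (fun ω => gradMat f (Xp ω) i j - gradMat f (X ω) i j) μ :=
      (((hAmeas i j).sub (hBmeas i j)).mono hm le_rfl).aestronglyMeasurable
    rw [memLp_two_iff_integrable_sq hmeas]
    refine (hstep.const_mul (L ^ 2)).mono' (hmeas.pow 2) (.of_forall fun ω => ?_)
    rw [Real.norm_of_nonneg (sq_nonneg _)]
    exact (sq_entry_le_frobNorm_sq (gradMat f (Xp ω) - gradMat f (X ω)) i j).trans
      (frobNorm_gradMat_sub_sq_le hlip _ _)
  have hB2 : ∀ i j, MemLp (fun ω => gradMat f (X ω) i j) 2 μ := fun i j => by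
    simpa only [Pi.sub_def, sub_sub_cancel] using (hA2 i j).sub (hAB2 i j)
  have herr : Integrable (fun ω => frobNorm (M ω - gradMat f (X ω)) ^ 2) μ :=
    integrable_frobNorm_sq fun i j => (hML2 i j).sub (hB2 i j)
  have hnoise : Integrable (fun ω => frobNorm (G ω - gradMat f (Xp ω)) ^ 2) μ :=
    integrable_frobNorm_sq fun i j => (hGL2 i j).sub (hA2 i j)
  have hnew : Integrable
      (fun ω => frobNorm ((1 - lam) • M ω + lam • G ω - gradMat f (Xp ω)) ^ 2) μ :=
    integrable_frobNorm_sq fun i j =>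
      (((hML2 i j).const_mul (1 - lam)).add ((hGL2 i j).const_mul lam)).sub (hA2 i j)
  have hcrossij : ∀ i j, Integrable (fun ω => (M ω i j - gradMat f (Xp ω) i j) *
      (G ω i j - gradMat f (Xp ω) i j)) μ := fun i j =>
    ((hML2 i j).sub (hA2 i j)).integrable_mul ((hGL2 i j).sub (hA2 i j))
  have hcross : Integrable (fun ω => ∑ i, ∑ j, (M ω i j - gradMat f (Xp ω) i j) *
      (G ω i j - gradMat f (Xp ω) i j)) μ :=
    integrable_finsetSum _ fun i _ => integrable_finsetSum _ fun j _ => hcrossij i j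
  have hcross0 : ∫ ω, ∑ i, ∑ j, (M ω i j - gradMat f (Xp ω) i j) *
      (G ω i j - gradMat f (Xp ω) i j) ∂μ = 0 := by
    rw [integral_finsetSum _ fun i _ => integrable_finsetSum _ fun j _ => hcrossij i j]
    refine Finset.sum_eq_zero fun i _ => ?_
    rw [integral_finsetSum _ fun j _ => hcrossij i j]
    exact Finset.sum_eq_zero fun j _ =>
      integral_mul_sub_condExp_eq_zero hm ((hMmeas i j).sub (hAmeas i j))
        ((hML2 i j).sub (hA2 i j)) (hGL2 i j) (hA2 i j) (hGcond i j)
  have hpoint : ∀ ω, frobNorm ((1 - lam) • M ω + lam • G ω - gradMat f (Xp ω)) ^ 2 ≤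
      (1 - lam) * frobNorm (M ω - gradMat f (X ω)) ^ 2
        + (1 - lam) ^ 2 / lam * L ^ 2 * frobNorm (Xp ω - X ω) ^ 2
        + lam ^ 2 * frobNorm (G ω - gradMat f (Xp ω)) ^ 2
        + 2 * lam * (1 - lam) * ∑ i, ∑ j, (M ω i j - gradMat f (Xp ω) i j) *
          (G ω i j - gradMat f (Xp ω) i j) := by
    intro ω
    have hyoung : frobNorm ((1 - lam) • M ω + lam • G ω - gradMat f (Xp ω)) ^ 2 ≤
        (1 - lam) * frobNorm (M ω - gradMat f (X ω)) ^ 2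
          + (1 - lam) ^ 2 / lam * frobNorm (gradMat f (Xp ω) - gradMat f (X ω)) ^ 2
          + lam ^ 2 * frobNorm (G ω - gradMat f (Xp ω)) ^ 2
          + 2 * lam * (1 - lam) * ∑ i, ∑ j, (M ω i j - gradMat f (Xp ω) i j) *
            (G ω i j - gradMat f (Xp ω) i j) := by
      simp only [frobNorm_sq, Finset.mul_sum, ← Finset.sum_add_distrib]
      exact Finset.sum_le_sum fun i _ => Finset.sum_le_sum fun j _ =>
        sq_momentum_error_le hpos hle _ _ _ _
    have hsmooth := mul_le_mul_of_nonneg_left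
      (frobNorm_gradMat_sub_sq_le hlip (Xp ω) (X ω))
      (div_nonneg (sq_nonneg (1 - lam)) hpos.le)
    linarith
  have hint := integral_mono hnew
    ((((herr.const_mul (1 - lam)).add
      (hstep.const_mul ((1 - lam) ^ 2 / lam * L ^ 2))).add
      (hnoise.const_mul (lam ^ 2))).add (hcross.const_mul (2 * lam * (1 - lam)))) hpoint
  rw [integral_add' (((herr.const_mul _).add (hstep.const_mul _)).add (hnoise.const_mul _))
      (hcross.const_mul _),
    integral_add' ((herr.const_mul _).add (hstep.const_mul _)) (hnoise.const_mul _),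
    integral_add' (herr.const_mul _) (hstep.const_mul _),
    integral_const_mul, integral_const_mul, integral_const_mul, integral_const_mul,
    hcross0] at hint
  have hvar := mul_le_mul_of_nonneg_left hGvar (sq_nonneg lam)
  linarith
end

section
/- Let (Ω, 𝓕, ℙ) be a probability space and 𝓖 ⊆ 𝓕 a sub-σ-algebra. Let m̄₋, Ḡ : Ω → ℝ^d be 𝓖-measurable and square-integrable, and let ḡ : Ω → ℝ^d be square-integrable with 𝔼[ḡ | 𝓖] = Ḡ almost surely and 𝔼‖ḡ − Ḡ‖² ≤ σ²/n. Fix λ ∈ (0,1] and set m̄ := (1 − λ) m̄₋ + λ ḡ. Then 𝔼‖m̄‖² ≤ (1 − λ) 𝔼‖m̄₋‖² + λ 𝔼‖Ḡ‖² + λ² σ²/n. -/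
open MeasureTheory

section

variable {Ω E : Type*} [NormedAddCommGroup E] [InnerProductSpace ℝ E]

/-- The pointwise inner product of two square-integrable functions is integrable. -/
lemma MeasureTheory.MemLp.integrable_real_inner {_ : MeasurableSpace Ω} {μ : Measure Ω}
    {f g : Ω → E} (hf : MemLp f 2 μ) (hg : MemLp g 2 μ) :
    Integrable (fun ω ↦ inner ℝ (f ω) (g ω)) μ := by
  refine (hf.norm.integrable_mul hg.norm).mono' (hf.1.inner hg.1) (.of_forall fun ω ↦ ?_)
  exact norm_inner_le_norm _ _

/-- A square-integrable `m`-measurable function is orthogonal to `g - μ[g | m]`. -/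
lemma integral_inner_sub_condExp_eq_zero [CompleteSpace E] {m mΩ : MeasurableSpace Ω}
    {μ : Measure Ω} [IsFiniteMeasure μ] (hm : m ≤ mΩ) {f g G : Ω → E}
    (hfm : StronglyMeasurable[m] f) (hf : MemLp f 2 μ) (hg : MemLp g 2 μ) (hG : MemLp G 2 μ)
    (hcond : μ[g | m] =ᵐ[μ] G) :
    ∫ ω, inner ℝ (f ω) (g ω - G ω) ∂μ = 0 := by
  have hfg := hf.integrable_real_inner hg
  have key : μ[fun ω ↦ inner ℝ (f ω) (g ω) | m] =ᵐ[μ] fun ω ↦ inner ℝ (f ω) (μ[g | m] ω) :=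
    condExp_bilin_of_stronglyMeasurable_left (innerSL ℝ) hfm hfg (hg.integrable one_le_two)
  have heq : ∫ ω, inner ℝ (f ω) (g ω) ∂μ = ∫ ω, inner ℝ (f ω) (G ω) ∂μ := by
    rw [← integral_condExp hm]
    refine integral_congr_ae ?_
    filter_upwards [key, hcond] with ω h₁ h₂
    rw [h₁, h₂]
  simp_rw [inner_sub_right]
  rw [integral_sub hfg (hf.integrable_real_inner hG), heq, sub_self]

/-- Convexity of the squared norm, with the endpoint `b` perturbed to `c`. -/
lemma norm_sq_convex_comb_le_add_inner {t : ℝ} (ht₀ : 0 ≤ t) (ht₁ : t ≤ 1) (a b c : E) :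
    ‖(1 - t) • a + t • c‖ ^ 2 ≤ (1 - t) * ‖a‖ ^ 2 + t * ‖b‖ ^ 2 + t ^ 2 * ‖c - b‖ ^ 2
      + 2 * t * inner ℝ ((1 - t) • a + t • b) (c - b) := by
  have hab : 0 ≤ t * (1 - t) * ‖a - b‖ ^ 2 :=
    mul_nonneg (mul_nonneg ht₀ (sub_nonneg.2 ht₁)) (sq_nonneg _)
  simp only [← real_inner_self_eq_norm_sq, inner_add_left, inner_add_right, inner_sub_left,
    inner_sub_right, real_inner_smul_left, real_inner_smul_right, real_inner_comm a b,
    real_inner_comm a c, real_inner_comm b c] at hab ⊢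
  linarith

end

/-- **Average momentum energy recursion.**
On a probability space with sub-σ-algebra `m ≤ 𝓕`: if `m̄₋, Ḡ` are `m`-measurable and
square-integrable, `ḡ` is square-integrable with `𝔼[ḡ|m] = Ḡ` a.s. and
`𝔼‖ḡ − Ḡ‖² ≤ σ²/n`, then for `m̄ := (1 − λ) m̄₋ + λ ḡ` with `λ ∈ (0,1]`,
`𝔼‖m̄‖² ≤ (1 − λ) 𝔼‖m̄₋‖² + λ 𝔼‖Ḡ‖² + λ² σ²/n`. -/
theorem average_momentum_energy_recursion {Ω : Type*} [msΩ : MeasurableSpace Ω]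
    (μ : Measure Ω) [IsProbabilityMeasure μ]
    (m : MeasurableSpace Ω) (hm : m ≤ msΩ)
    {d n : ℕ} (σ lam : ℝ) (hlam : lam ∈ Set.Ioc (0 : ℝ) 1)
    (mmPrev G : Ω → EuclideanSpace ℝ (Fin d))
    (hmmMeas : StronglyMeasurable[m] mmPrev) (hGMeas : StronglyMeasurable[m] G)
    (hmmL2 : MemLp mmPrev 2 μ) (hGL2 : MemLp G 2 μ)
    (g : Ω → EuclideanSpace ℝ (Fin d)) (hgL2 : MemLp g 2 μ)
    (hcond : μ[g | m] =ᵐ[μ] G)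
    (hvar : ∫ ω, ‖g ω - G ω‖ ^ 2 ∂μ ≤ σ ^ 2 / (n : ℝ)) :
    ∫ ω, ‖(1 - lam) • mmPrev ω + lam • g ω‖ ^ 2 ∂μ ≤
      (1 - lam) * ∫ ω, ‖mmPrev ω‖ ^ 2 ∂μ + lam * ∫ ω, ‖G ω‖ ^ 2 ∂μ
        + lam ^ 2 * σ ^ 2 / (n : ℝ) := by
  have hconv : MemLp (fun ω ↦ (1 - lam) • mmPrev ω + lam • G ω) 2 μ :=
    (hmmL2.const_smul (1 - lam)).add (hGL2.const_smul lam)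
  have horth : ∫ ω, inner ℝ ((1 - lam) • mmPrev ω + lam • G ω) (g ω - G ω) ∂μ = 0 :=
    integral_inner_sub_condExp_eq_zero hm
      ((hmmMeas.const_smul (1 - lam)).add (hGMeas.const_smul lam)) hconv hgL2 hGL2 hcond
  have hsub : MemLp (fun ω ↦ g ω - G ω) 2 μ := hgL2.sub hGL2
  have hlhs : MemLp (fun ω ↦ (1 - lam) • mmPrev ω + lam • g ω) 2 μ :=
    (hmmL2.const_smul (1 - lam)).add (hgL2.const_smul lam)
  have iM := (hmmL2.integrable_norm_pow two_ne_zero).const_mul (1 - lam)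
  have iG := (hGL2.integrable_norm_pow two_ne_zero).const_mul lam
  have iS := (hsub.integrable_norm_pow two_ne_zero).const_mul (lam ^ 2)
  have iI := (hconv.integrable_real_inner hsub).const_mul (2 * lam)
  calc ∫ ω, ‖(1 - lam) • mmPrev ω + lam • g ω‖ ^ 2 ∂μ
      ≤ ∫ ω, ((1 - lam) * ‖mmPrev ω‖ ^ 2 + lam * ‖G ω‖ ^ 2 + lam ^ 2 * ‖g ω - G ω‖ ^ 2
          + 2 * lam * inner ℝ ((1 - lam) • mmPrev ω + lam • G ω) (g ω - G ω)) ∂μ :=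
        integral_mono (hlhs.integrable_norm_pow two_ne_zero) (((iM.add iG).add iS).add iI)
          fun ω ↦ norm_sq_convex_comb_le_add_inner hlam.1.le hlam.2 _ _ _
    _ = (1 - lam) * ∫ ω, ‖mmPrev ω‖ ^ 2 ∂μ + lam * ∫ ω, ‖G ω‖ ^ 2 ∂μ
          + lam ^ 2 * ∫ ω, ‖g ω - G ω‖ ^ 2 ∂μ := by
        rw [integral_add ((iM.fun_add iG).fun_add iS) iI, integral_add (iM.fun_add iG) iS,
          integral_add iM iG]
        simp only [integral_const_mul, horth, mul_zero, add_zero]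
    _ ≤ _ := by
        rw [mul_div_assoc]
        gcongr
end
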